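/- Let (X,d) be a Polish metric space, let κ be a Markov kernel from X to X, and let C ≥ 0. Assume that W₂(κ(x,·), κ(y,·)) ≤ C·d(x,y) for all x, y ∈ X. Then for all Borel probability measures μ, ν on X one has W₂(μκ, νκ) ≤ C·W₂(μ,ν). -/

import Mathlib

open MeasureTheory ProbabilityTheory
open scoped ENNReal

/-- A coupling of `μ` and `ν`: a probability measure on `X × X` with marginals `μ` and `ν`. -/
def IsCoupling {X : Type*} [MeasurableSpace X] (q : Measure (X × X)) (μ ν : Measure X) : Prop :=
  IsProbabilityMeasure q ∧ q.map Prod.fst = μ ∧ q.map Prod.snd = ν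

/-- The L²-Kantorovich–Wasserstein distance `W₂(μ,ν)`, valued in `[0,∞]`:
the infimum of `(∫ d(x,y)² dq)^(1/2)` over all couplings `q` of `μ` and `ν`. -/
noncomputable def W2 {X : Type*} [EDist X] [MeasurableSpace X] (μ ν : Measure X) : ℝ≥0∞ :=
  (sInf { c : ℝ≥0∞ | ∃ q : Measure (X × X), IsCoupling q μ ν ∧
      c = ∫⁻ p, edist p.1 p.2 ^ 2 ∂q }) ^ ((1 : ℝ) / 2)

open Filter Topology BoundedContinuousFunction
open scoped NNReal

section Wasserstein

variable {X : Type*} [MeasurableSpace X]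

lemma IsCoupling.prod (μ ν : Measure X) [IsProbabilityMeasure μ] [IsProbabilityMeasure ν] :
    IsCoupling (μ.prod ν) μ ν :=
  ⟨inferInstance, by simp, by simp⟩

lemma W2_sq [EDist X] (μ ν : Measure X) :
    W2 μ ν ^ 2 = sInf { c : ℝ≥0∞ | ∃ q : Measure (X × X), IsCoupling q μ ν ∧
      c = ∫⁻ p, edist p.1 p.2 ^ 2 ∂q } := by
  rw [W2, ← ENNReal.rpow_natCast, ← ENNReal.rpow_mul]
  norm_num

lemma exists_isCoupling_lintegral_lt [EDist X] {μ ν : Measure X} {c : ℝ≥0∞}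
    (h : W2 μ ν ^ 2 < c) :
    ∃ q : Measure (X × X), IsCoupling q μ ν ∧ ∫⁻ p, edist p.1 p.2 ^ 2 ∂q < c := by
  rw [W2_sq, sInf_lt_iff] at h
  obtain ⟨_, ⟨q, hq, rfl⟩, hlt⟩ := h
  exact ⟨q, hq, hlt⟩

lemma IsCoupling.W2_sq_le [EDist X] {μ ν : Measure X} {q : Measure (X × X)}
    (hq : IsCoupling q μ ν) : W2 μ ν ^ 2 ≤ ∫⁻ p, edist p.1 p.2 ^ 2 ∂q := by
  rw [W2_sq]
  exact sInf_le ⟨q, hq, rfl⟩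

/-- Averaging couplings `Γ (x, y)` of `κ x` and `η y` over a coupling of `μ` and `ν` gives a
coupling of the mixtures. -/
lemma IsCoupling.bind {μ ν : Measure X} {q : Measure (X × X)} (hq : IsCoupling q μ ν)
    {κ η : X → Measure X} (hκ : Measurable κ) (hη : Measurable η)
    {Γ : X × X → Measure (X × X)} (hΓ : Measurable Γ)
    (h : ∀ p, IsCoupling (Γ p) (κ p.1) (η p.2)) :
    IsCoupling (q.bind Γ) (μ.bind κ) (ν.bind η) := by
  obtain ⟨hq0, rfl, rfl⟩ := hq
  refine ⟨⟨?_⟩, ?_, ?_⟩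
  · have (p : X × X) : Γ p Set.univ = 1 := (h p).1.measure_univ
    simp [Measure.bind_apply MeasurableSet.univ hΓ.aemeasurable, this]
  · ext s hs
    rw [Measure.map_apply measurable_fst hs,
      Measure.bind_apply (measurable_fst hs) hΓ.aemeasurable,
      Measure.bind_apply hs hκ.aemeasurable,
      lintegral_map (f := fun x ↦ κ x s) ((Measure.measurable_coe hs).comp hκ) measurable_fst]
    refine lintegral_congr fun p ↦ ?_
    rw [← (h p).2.1, Measure.map_apply measurable_fst hs]
  · ext s hs
    rw [Measure.map_apply measurable_snd hs,
      Measure.bind_apply (measurable_snd hs) hΓ.aemeasurable,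
      Measure.bind_apply hs hη.aemeasurable,
      lintegral_map (f := fun x ↦ η x s) ((Measure.measurable_coe hs).comp hη) measurable_snd]
    refine lintegral_congr fun p ↦ ?_
    rw [← (h p).2.2, Measure.map_apply measurable_snd hs]

variable [MetricSpace X] [SecondCountableTopology X] [BorelSpace X]

/-- The Lévy–Prokhorov distance is controlled by the Wasserstein distance. -/
lemma levyProkhorovEDist_pow_three_le (μ ν : Measure X) [IsProbabilityMeasure μ]
    [IsProbabilityMeasure ν] : levyProkhorovEDist μ ν ^ 3 ≤ W2 μ ν ^ 2 := by
  refine le_of_forall_gt fun c hc ↦ ?_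
  obtain ⟨q, ⟨hq0, hq1, hq2⟩, hlt⟩ := exists_isCoupling_lintegral_lt hc
  refine lt_of_le_of_lt ?_ hlt
  set I := ∫⁻ p, edist p.1 p.2 ^ 2 ∂q
  suffices h : levyProkhorovEDist μ ν ≤ I ^ (1 / 3 : ℝ) by
    calc levyProkhorovEDist μ ν ^ 3 ≤ (I ^ (1 / 3 : ℝ)) ^ 3 := by gcongr
      _ = I := by rw [← ENNReal.rpow_natCast, ← ENNReal.rpow_mul]; norm_num
  refine levyProkhorovEDist_le_of_forall_le μ ν _ fun ε B hε hε_top hB ↦ ?_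
  have hε0 : ε ≠ 0 := (zero_le.trans_lt hε).ne'
  have hIε : I ≤ ε ^ 3 := by
    calc I = (I ^ (1 / 3 : ℝ)) ^ 3 := by
          rw [← ENNReal.rpow_natCast, ← ENNReal.rpow_mul]; norm_num
      _ ≤ ε ^ 3 := by gcongr
  have hdist : Measurable fun p : X × X ↦ edist p.1 p.2 ^ 2 := by fun_prop
  have hmarkov : q {p | ε ^ 2 ≤ edist p.1 p.2 ^ 2} ≤ ε := by
    refine (meas_ge_le_lintegral_div hdist.aemeasurable (pow_ne_zero 2 hε0)
      (ENNReal.pow_ne_top hε_top.ne)).trans ?_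
    refine ENNReal.div_le_of_le_mul (hIε.trans_eq ?_)
    ring
  have hsub : Prod.fst ⁻¹' B ⊆ Prod.snd ⁻¹' (Metric.thickening ε.toReal B) ∪
      {p : X × X | ε ^ 2 ≤ edist p.1 p.2 ^ 2} := by
    intro p hp
    by_cases hlt : edist p.1 p.2 < ε
    · left
      rw [Set.mem_preimage, Metric.mem_thickening_iff]
      refine ⟨p.1, hp, ?_⟩
      rw [dist_comm, dist_edist]
      exact ENNReal.toReal_strict_mono hε_top.ne hlt
    · right
      exact pow_le_pow_left' (not_lt.mp hlt) 2
  calc μ B = q (Prod.fst ⁻¹' B) := by rw [← hq1, Measure.map_apply measurable_fst hB]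
    _ ≤ q (Prod.snd ⁻¹' (Metric.thickening ε.toReal B)) +
        q {p | ε ^ 2 ≤ edist p.1 p.2 ^ 2} := (measure_mono hsub).trans (measure_union_le _ _)
    _ ≤ ν (Metric.thickening ε.toReal B) + ε := by
      rw [← hq2, Measure.map_apply measurable_snd Metric.isOpen_thickening.measurableSet]
      gcongr

lemma tendsto_of_tendsto_W2 {ι : Type*} {l : Filter ι} {μs : ι → ProbabilityMeasure X}
    {μ : ProbabilityMeasure X}
    (h : Tendsto (fun i ↦ W2 (μs i : Measure X) (μ : Measure X)) l (𝓝 0)) :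
    Tendsto μs l (𝓝 μ) := by
  rw [(LevyProkhorov.probabilityMeasureHomeomorph (Ω := X)).isInducing.tendsto_nhds_iff,
    tendsto_iff_edist_tendsto_0]
  have h2 : Tendsto (fun i ↦ (W2 (μs i : Measure X) (μ : Measure X) ^ 2) ^ (1 / 3 : ℝ)) l
      (𝓝 0) := by
    have := ((ENNReal.continuous_rpow_const (y := 1 / 3)).comp (ENNReal.continuous_pow 2)).tendsto 0
    simpa [Function.comp_def] using this.comp h
  refine tendsto_of_tendsto_of_tendsto_of_le_of_le tendsto_const_nhds h2 (fun _ ↦ zero_le)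
    fun i ↦ ?_
  change levyProkhorovEDist (μs i : Measure X) (μ : Measure X) ≤ _
  calc levyProkhorovEDist (μs i : Measure X) (μ : Measure X)
      = (levyProkhorovEDist (μs i : Measure X) (μ : Measure X) ^ 3) ^ (1 / 3 : ℝ) := by
        rw [← ENNReal.rpow_natCast, ← ENNReal.rpow_mul]; norm_num
    _ ≤ _ := ENNReal.rpow_le_rpow (levyProkhorovEDist_pow_three_le _ _) (by norm_num)

variable [CompleteSpace X]

/-- Lower semicontinuity of the Wasserstein distance under weak convergence. -/
lemma W2_sq_le_of_tendsto {μs νs : ℕ → ProbabilityMeasure X} {μ ν : ProbabilityMeasure X}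
    (hμ : Tendsto μs atTop (𝓝 μ)) (hν : Tendsto νs atTop (𝓝 ν))
    {qs : ℕ → Measure (X × X)} (hqs : ∀ n, IsCoupling (qs n) (μs n) (νs n))
    {c : ℕ → ℝ≥0∞} {a : ℝ≥0∞} (hc : Tendsto c atTop (𝓝 a))
    (hle : ∀ n, ∫⁻ p, edist p.1 p.2 ^ 2 ∂(qs n) ≤ c n) :
    W2 (μ : Measure X) (ν : Measure X) ^ 2 ≤ a := by
  let Q : ℕ → ProbabilityMeasure (X × X) := fun n ↦ ⟨qs n, (hqs n).1⟩
  have tight {ρs : ℕ → ProbabilityMeasure X} {ρ : ProbabilityMeasure X}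
      (hρ : Tendsto ρs atTop (𝓝 ρ)) :
      IsTightMeasureSet {((π : ProbabilityMeasure X) : Measure X) | π ∈ Set.range ρs} := by
    apply isTightMeasureSet_of_isCompact_closure
    exact hρ.isCompact_insert_range.closure_of_subset (Set.subset_insert _ _)
  have tightQ : IsTightMeasureSet
      {((π : ProbabilityMeasure (X × X)) : Measure (X × X)) | π ∈ Set.range Q} := by
    refine IsTightMeasureSet.prodMk ((tight hμ).subset ?_) ((tight hν).subset ?_)
    · rintro _ ⟨_, ⟨_, ⟨n, rfl⟩, rfl⟩, rfl⟩
      exact ⟨μs n, ⟨n, rfl⟩, (hqs n).2.1.symm⟩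
    · rintro _ ⟨_, ⟨_, ⟨n, rfl⟩, rfl⟩, rfl⟩
      exact ⟨νs n, ⟨n, rfl⟩, (hqs n).2.2.symm⟩
  obtain ⟨q, -, φ, hφ, hq⟩ := (isCompact_closure_of_isTightMeasureSet tightQ).tendsto_subseq
    (fun n ↦ subset_closure (Set.mem_range_self n))
  have hfst : q.map measurable_fst.aemeasurable = μ := by
    refine tendsto_nhds_unique (ProbabilityMeasure.tendsto_map_of_tendsto_of_continuous _ q hq
      continuous_fst) ((hμ.comp hφ.tendsto_atTop).congr fun n ↦ ?_)
    exact Subtype.ext (hqs (φ n)).2.1.symm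
  have hsnd : q.map measurable_snd.aemeasurable = ν := by
    refine tendsto_nhds_unique (ProbabilityMeasure.tendsto_map_of_tendsto_of_continuous _ q hq
      continuous_snd) ((hν.comp hφ.tendsto_atTop).congr fun n ↦ ?_)
    exact Subtype.ext (hqs (φ n)).2.2.symm
  have hcoup : IsCoupling (q : Measure (X × X)) μ ν :=
    ⟨q.2, congrArg Subtype.val hfst, congrArg Subtype.val hsnd⟩
  refine hcoup.W2_sq_le.trans ?_
  have hcost (p : X × X) : edist p.1 p.2 ^ 2 = ENNReal.ofReal (dist p.1 p.2 ^ 2) := by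
    rw [edist_dist, ENNReal.ofReal_pow dist_nonneg]
  calc ∫⁻ p, edist p.1 p.2 ^ 2 ∂(q : Measure (X × X))
      ≤ atTop.liminf fun n ↦ ∫⁻ p, edist p.1 p.2 ^ 2 ∂(Q (φ n) : Measure (X × X)) := by
        simp_rw [hcost]
        exact lintegral_le_liminf_lintegral_of_forall_isOpen_measure_le_liminf_measure
          (by fun_prop) (fun _ ↦ sq_nonneg _)
          fun G hG ↦ ProbabilityMeasure.le_liminf_measure_open_of_tendsto hq hG
    _ ≤ atTop.liminf (c ∘ φ) := liminf_le_liminf (.of_forall fun n ↦ hle (φ n))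
    _ = a := (hc.comp hφ.tendsto_atTop).liminf_eq

end Wasserstein

lemma ENNReal.add_two_mul_sq_le (a b : ℝ≥0∞) :
    (a + 2 * b) ^ 2 ≤ (1 + 2 * b) * a ^ 2 + (2 * b + 4 * b ^ 2) := by
  have h : 2 * a ≤ a ^ 2 + 1 := by
    induction a with
    | top => simp
    | coe a =>
      norm_cast
      rw [← NNReal.coe_le_coe]
      push_cast
      nlinarith [sq_nonneg ((a : ℝ) - 1)]
  calc (a + 2 * b) ^ 2 = a ^ 2 + 2 * b * (2 * a) + 4 * b ^ 2 := by ring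
    _ ≤ a ^ 2 + 2 * b * (a ^ 2 + 1) + 4 * b ^ 2 := by gcongr
    _ = _ := by ring

/-- In a separable metric space the identity is a uniform limit of measurable functions that factor
through `ℕ`. -/
lemma exists_measurable_nat_edist_lt {X : Type*} [MetricSpace X] [SecondCountableTopology X]
    [MeasurableSpace X] [BorelSpace X] [Nonempty X] {ε : ℝ≥0∞} (hε : 0 < ε) :
    ∃ N : X → ℕ, Measurable N ∧ ∀ x, edist (TopologicalSpace.denseSeq X (N x)) x < ε := by
  classical
  have h (x : X) : ∃ n, edist (TopologicalSpace.denseSeq X n) x < ε := by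
    obtain ⟨n, hn⟩ := (TopologicalSpace.denseRange_denseSeq X).exists_mem_open
      (Metric.isOpen_eball (x := x) (ε := ε)) ⟨x, Metric.mem_eball_self hε⟩
    exact ⟨n, hn⟩
  refine ⟨fun x ↦ Nat.find (h x), measurable_find h fun k ↦ ?_, fun x ↦ Nat.find_spec (h x)⟩
  exact measurableSet_lt (by fun_prop) measurable_const

section Kernel

variable {X : Type*} [MetricSpace X] [SecondCountableTopology X] [MeasurableSpace X] [BorelSpace X]

/-- The mixture `μκ` as a bundled probability measure. -/
noncomputable def bindProbabilityMeasure (μ : Measure X) [IsProbabilityMeasure μ] (κ : Kernel X X)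
    [IsMarkovKernel κ] : ProbabilityMeasure X :=
  ⟨μ.bind κ, inferInstance⟩

lemma tendsto_bind_comp {C : ℝ} {κ : Kernel X X} [IsMarkovKernel κ]
    (hκ : ∀ x y : X, W2 (κ x) (κ y) ≤ ENNReal.ofReal C * edist x y)
    (μ : Measure X) [IsProbabilityMeasure μ] {s : ℕ → X → X} (hs : ∀ n, Measurable (s n))
    (hlim : ∀ x, Tendsto (fun n ↦ edist (s n x) x) atTop (𝓝 0)) :
    Tendsto (fun n ↦ bindProbabilityMeasure μ (κ.comap (s n) (hs n))) atTop
      (𝓝 (bindProbabilityMeasure μ κ)) := by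
  let P : X → ProbabilityMeasure X := fun x ↦ ⟨κ x, inferInstance⟩
  have hpt (x : X) : Tendsto (fun n ↦ P (s n x)) atTop (𝓝 (P x)) := by
    refine tendsto_of_tendsto_W2 (tendsto_of_tendsto_of_tendsto_of_le_of_le tendsto_const_nhds
      ?_ (fun _ ↦ zero_le) fun n ↦ hκ (s n x) x)
    simpa using ENNReal.Tendsto.const_mul (hlim x) (Or.inr ENNReal.ofReal_ne_top)
  rw [ProbabilityMeasure.tendsto_iff_forall_lintegral_tendsto]
  intro f
  have hf : Measurable fun x ↦ (f x : ℝ≥0∞) := by fun_prop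
  simp only [bindProbabilityMeasure, ProbabilityMeasure.coe_mk]
  simp_rw [Measure.lintegral_bind (Kernel.measurable _).aemeasurable hf.aemeasurable]
  refine tendsto_lintegral_of_dominated_convergence (fun _ ↦ (nndist f 0 : ℝ≥0∞))
    (fun n ↦ hf.lintegral_kernel) (fun n ↦ .of_forall fun x ↦ ?_) (by simp)
    (.of_forall fun x ↦ ?_)
  · calc ∫⁻ y, (f y : ℝ≥0∞) ∂(κ.comap (s n) (hs n) x)
        ≤ ∫⁻ _, (nndist f 0 : ℝ≥0∞) ∂(κ.comap (s n) (hs n) x) := by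
          gcongr with y
          exact BoundedContinuousFunction.NNReal.upper_bound f y
      _ = nndist f 0 := by simp
  · exact ProbabilityMeasure.tendsto_iff_forall_lintegral_tendsto.mp (hpt x) f

variable [CompleteSpace X]

lemma W2_sq_bind_le {C : ℝ} {κ : Kernel X X} [IsMarkovKernel κ]
    (hκ : ∀ x y : X, W2 (κ x) (κ y) ≤ ENNReal.ofReal C * edist x y)
    {μ ν : Measure X} [IsProbabilityMeasure μ] [IsProbabilityMeasure ν] {q : Measure (X × X)}
    (hq : IsCoupling q μ ν) :
    W2 (μ.bind κ) (ν.bind κ) ^ 2 ≤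
      ENNReal.ofReal C ^ 2 * ∫⁻ p, edist p.1 p.2 ^ 2 ∂q := by
  have hX : Nonempty X := nonempty_of_isProbabilityMeasure μ
  have hq0 := hq.1
  set K := ENNReal.ofReal C
  have hK : K ≠ ∞ := ENNReal.ofReal_ne_top
  obtain ⟨η, -, hη, hηlim⟩ := exists_seq_strictAnti_tendsto' (zero_lt_one (α := ℝ≥0∞))
  choose N hN hNlt using fun n ↦ exists_measurable_nat_edist_lt (X := X) (hη n).1
  set d := TopologicalSpace.denseSeq X
  have hW (n i j : ℕ) : W2 (κ (d i)) (κ (d j)) ^ 2 < (K * edist (d i) (d j)) ^ 2 + η n :=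
    (pow_le_pow_left' (hκ _ _) 2).trans_lt (ENNReal.lt_add_right
      (ENNReal.pow_ne_top (ENNReal.mul_ne_top hK (edist_ne_top _ _))) (hη n).1.ne')
  choose π hπ hπlt using fun n i j ↦ exists_isCoupling_lintegral_lt (hW n i j)
  let s : ℕ → X → X := fun n x ↦ d (N n x)
  have hs (n : ℕ) : Measurable (s n) := (measurable_from_nat (f := d)).comp (hN n)
  have hlim (x : X) : Tendsto (fun n ↦ edist (s n x) x) atTop (𝓝 0) :=
    tendsto_of_tendsto_of_tendsto_of_le_of_le tendsto_const_nhds hηlim (fun _ ↦ zero_le)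
      fun n ↦ (hNlt n x).le
  let Γ : ℕ → X × X → Measure (X × X) := fun n p ↦ π n (N n p.1) (N n p.2)
  have hΓ (n : ℕ) : Measurable (Γ n) :=
    (Measurable.of_discrete (f := fun ij : ℕ × ℕ ↦ π n ij.1 ij.2)).comp
      (((hN n).comp measurable_fst).prodMk ((hN n).comp measurable_snd))
  have hdist : Measurable fun p : X × X ↦ edist p.1 p.2 ^ 2 := by fun_prop
  set I := ∫⁻ p, edist p.1 p.2 ^ 2 ∂q
  by_cases htop : K ≠ 0 ∧ I = ∞
  · simp [htop.1, htop.2]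
  have hc : Tendsto (fun n ↦ K ^ 2 * ((1 + 2 * η n) * I + (2 * η n + 4 * η n ^ 2)) + η n) atTop
      (𝓝 (K ^ 2 * I)) := by
    rcases eq_or_ne K 0 with hK0 | hK0
    · simpa [hK0] using hηlim
    have hI : I ≠ ∞ := fun h ↦ htop ⟨hK0, h⟩
    have h2 : Tendsto (fun n ↦ 2 * η n) atTop (𝓝 0) := by
      simpa using ENNReal.Tendsto.const_mul (a := 2) hηlim (by simp)
    have hsq : Tendsto (fun n ↦ 4 * η n ^ 2) atTop (𝓝 0) := by
      simpa using ENNReal.Tendsto.const_mul (a := 4)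
        (((ENNReal.continuous_pow 2).tendsto 0).comp hηlim) (by simp)
    have h1 : Tendsto (fun n ↦ (1 + 2 * η n) * I) atTop (𝓝 I) := by
      simpa using ENNReal.Tendsto.mul_const ((tendsto_const_nhds (x := (1 : ℝ≥0∞))).add h2) (Or.inr hI)
    simpa using (ENNReal.Tendsto.const_mul (h1.add (h2.add hsq))
      (Or.inr (ENNReal.pow_ne_top hK))).add hηlim
  have hle (n : ℕ) : ∫⁻ p, edist p.1 p.2 ^ 2 ∂(q.bind (Γ n)) ≤
      K ^ 2 * ((1 + 2 * η n) * I + (2 * η n + 4 * η n ^ 2)) + η n := by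
    rw [Measure.lintegral_bind (hΓ n).aemeasurable hdist.aemeasurable]
    have hpt (p : X × X) : ∫⁻ z, edist z.1 z.2 ^ 2 ∂(Γ n p) ≤
        K ^ 2 * ((1 + 2 * η n) * edist p.1 p.2 ^ 2 + (2 * η n + 4 * η n ^ 2)) + η n := by
      have htri : edist (s n p.1) (s n p.2) ≤ edist p.1 p.2 + 2 * η n := by
        calc edist (s n p.1) (s n p.2)
            ≤ edist (s n p.1) p.1 + edist p.1 p.2 + edist p.2 (s n p.2) := edist_triangle4 _ _ _ _
          _ ≤ η n + edist p.1 p.2 + η n := by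
            gcongr
            · exact (hNlt n p.1).le
            · rw [edist_comm]; exact (hNlt n p.2).le
          _ = edist p.1 p.2 + 2 * η n := by ring
      calc ∫⁻ z, edist z.1 z.2 ^ 2 ∂(Γ n p)
          ≤ (K * edist (s n p.1) (s n p.2)) ^ 2 + η n := (hπlt n _ _).le
        _ ≤ (K * (edist p.1 p.2 + 2 * η n)) ^ 2 + η n := by gcongr
        _ = K ^ 2 * (edist p.1 p.2 + 2 * η n) ^ 2 + η n := by rw [mul_pow]
        _ ≤ _ := by gcongr; exact ENNReal.add_two_mul_sq_le _ _
    calc ∫⁻ p, ∫⁻ z, edist z.1 z.2 ^ 2 ∂(Γ n p) ∂q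
        ≤ ∫⁻ p, (K ^ 2 * ((1 + 2 * η n) * edist p.1 p.2 ^ 2 + (2 * η n + 4 * η n ^ 2)) + η n) ∂q :=
          lintegral_mono hpt
      _ = _ := by
        rw [lintegral_add_right _ measurable_const, lintegral_const_mul _ (by fun_prop),
          lintegral_add_right _ measurable_const, lintegral_const_mul _ hdist]
        simp [I]
  exact W2_sq_le_of_tendsto (tendsto_bind_comp hκ μ hs hlim) (tendsto_bind_comp hκ ν hs hlim)
    (fun n ↦ hq.bind (Kernel.measurable _) (Kernel.measurable _) (hΓ n) fun p ↦ hπ n _ _) hc hle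

end Kernel

/-- If a Markov kernel `κ` on a Polish metric space satisfies
`W₂(κ(x,·), κ(y,·)) ≤ C·d(x,y)` for all `x, y`, then `W₂(μκ, νκ) ≤ C·W₂(μ,ν)`
for all Borel probability measures `μ, ν`. -/
theorem wasserstein_contraction_of_kernel
    {X : Type*} [MetricSpace X] [CompleteSpace X] [SecondCountableTopology X]
    [MeasurableSpace X] [BorelSpace X]
    (κ : Kernel X X) [IsMarkovKernel κ] (C : ℝ) (hC : 0 ≤ C)
    (hκ : ∀ x y : X, W2 (κ x) (κ y) ≤ ENNReal.ofReal C * edist x y)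
    (μ ν : Measure X) [IsProbabilityMeasure μ] [IsProbabilityMeasure ν] :
    W2 (μ.bind (fun x => κ x)) (ν.bind (fun x => κ x)) ≤ ENNReal.ofReal C * W2 μ ν := by
  have hsq : W2 (μ.bind κ) (ν.bind κ) ^ 2 ≤ (ENNReal.ofReal C * W2 μ ν) ^ 2 := by
    rw [mul_pow, W2_sq μ ν, sInf_eq_iInf']
    have : Nonempty { c : ℝ≥0∞ | ∃ q : Measure (X × X), IsCoupling q μ ν ∧
        c = ∫⁻ p, edist p.1 p.2 ^ 2 ∂q } := ⟨_, _, IsCoupling.prod μ ν, rfl⟩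
    rw [ENNReal.mul_iInf fun h ↦ absurd h (ENNReal.pow_ne_top ENNReal.ofReal_ne_top)]
    refine le_iInf ?_
    rintro ⟨_, q, hq, rfl⟩
    exact W2_sq_bind_le hκ hq
  exact (ENNReal.pow_le_pow_left_iff two_ne_zero).mp hsq
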